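/- arXiv:1911.01095 — 4 statements merged into one kernel-verified Lean document; each statement's English description precedes it below -/
import Mathlib

section
/- Let d ≥ 1 and p ≥ 0. If v is a real polynomial in d variables of total degree at most p such that ∫_{α+Ŝ} v(x) dx = 0 for every multi-index α ∈ ℕ^d with |α| ≤ p, then v is the zero polynomial. (Core of Lemma 4.1: the sub-cell averaging map is injective on polynomials of degree p.) -/
open MeasureTheory

/-- The closed unit simplex `Ŝ = {x ∈ ℝ^d : xᵢ ≥ 0, ∑ xᵢ ≤ 1}`. -/
def unitSimplex (d : ℕ) : Set (Fin d → ℝ) :=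
  {x | (∀ i, 0 ≤ x i) ∧ ∑ i, x i ≤ 1}

theorem isCompact_unitSimplex (d : ℕ) : IsCompact (unitSimplex d) := by
  refine (isCompact_Icc (a := (0 : Fin d → ℝ)) (b := 1)).of_isClosed_subset ?_ ?_
  · exact (isClosed_le continuous_const continuous_id :
      IsClosed {x : Fin d → ℝ | (0 : Fin d → ℝ) ≤ x}).inter
      (isClosed_le (continuous_finsetSum _ fun i _ => continuous_apply i) continuous_const)
  · rintro x ⟨hx, hsum⟩
    exact ⟨hx, fun i =>
      (Finset.single_le_sum (fun j _ => hx j) (Finset.mem_univ i)).trans hsum⟩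

theorem volume_unitSimplex_pos (d : ℕ) : 0 < volume (unitSimplex d) := by
  have hopen : IsOpen {x : Fin d → ℝ | (∀ i, 0 < x i) ∧ ∑ i, x i < 1} := by
    rw [Set.ofPred_and, Set.ofPred_forall]
    exact (isOpen_iInter_of_finite fun i => isOpen_lt continuous_const (continuous_apply i)).inter
      (isOpen_lt (continuous_finsetSum _ fun i _ => continuous_apply i) continuous_const)
  refine (hopen.measure_pos volume ⟨fun _ => 1 / (d + 1 : ℝ), fun _ => by positivity, ?_⟩).trans_le
    (measure_mono fun x hx => ⟨fun i => (hx.1 i).le, hx.2.le⟩)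
  have hd : (0 : ℝ) < d + 1 := by positivity
  simp [← div_eq_mul_inv, div_lt_one hd]

/-- The integral over a translate of the unit simplex, pulled back to the unit simplex. -/
theorem setIntegral_image_add_unitSimplex {d : ℕ} (a : Fin d → ℝ) (f : (Fin d → ℝ) → ℝ) :
    ∫ x in (fun y : Fin d → ℝ => fun i => a i + y i) '' unitSimplex d, f x =
      ∫ x in unitSimplex d, f (a + x) :=
  (measurePreserving_add_left volume a).setIntegral_image_emb
    (measurableEmbedding_addLeft a) f (unitSimplex d)

/-- The coefficient of `v (β + x)` in the mixed forward difference of order `α` of `v` at `x`. -/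
def mixedDiffWeight {d : ℕ} (α β : Fin d → ℕ) : ℝ :=
  ∏ i, (-1 : ℝ) ^ (α i - β i) * (α i).choose (β i)

theorem sum_mixedDiffWeight_mul_prod_pow {d : ℕ} (α m : Fin d → ℕ) (x : Fin d → ℝ) :
    ∑ β ∈ Fintype.piFinset fun i => Finset.range (α i + 1),
        mixedDiffWeight α β * ∏ i, ((β i : ℝ) + x i) ^ m i =
      ∏ i, (fwdDiff (1 : ℝ))^[α i] (fun t : ℝ => t ^ m i) (x i) := by
  simp_rw [mixedDiffWeight, ← Finset.prod_mul_distrib, fwdDiff_iter_eq_sum_shift]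
  rw [Finset.prod_univ_sum]
  refine Finset.sum_congr rfl fun β _ => Finset.prod_congr rfl fun i _ => ?_
  simp [add_comm]

/-- A mixed forward difference whose order is at least the total degree extracts a coefficient. -/
theorem sum_mixedDiffWeight_mul_eval {d : ℕ} (v : MvPolynomial (Fin d) ℝ) (α : Fin d →₀ ℕ)
    (hα : v.totalDegree ≤ ∑ i, α i) (x : Fin d → ℝ) :
    ∑ β ∈ Fintype.piFinset fun i => Finset.range (α i + 1),
        mixedDiffWeight α β * MvPolynomial.eval (fun i => (β i : ℝ) + x i) v =
      v.coeff α * ∏ i, ((α i).factorial : ℝ) := by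
  simp_rw [MvPolynomial.eval_eq', Finset.mul_sum]
  rw [Finset.sum_comm]
  simp_rw [mul_left_comm _ (MvPolynomial.coeff _ v), ← Finset.mul_sum,
    sum_mixedDiffWeight_mul_prod_pow]
  rw [Finset.sum_eq_single α]
  · congr 1
    refine Finset.prod_congr rfl fun i _ => ?_
    rw [fwdDiff_iter_eq_factorial]
    simp
  · intro m hm hne
    have hle : ∑ i, m i ≤ ∑ i, α i := by
      have := MvPolynomial.le_totalDegree hm
      rw [Finsupp.sum_fintype _ _ fun _ => rfl] at this
      exact this.trans hα
    obtain ⟨i, hi⟩ : ∃ i, m i < α i := by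
      by_contra! h
      refine hne (Finsupp.ext fun i => ?_)
      exact ((Finset.sum_eq_sum_iff_of_le fun i _ => h i).1
        ((Finset.sum_le_sum fun i _ => h i).antisymm hle) i (Finset.mem_univ i)).symm
    rw [Finset.prod_eq_zero (Finset.mem_univ i), mul_zero]
    rw [fwdDiff_iter_pow_eq_zero_of_lt hi]
    rfl
  · intro h
    simp [MvPolynomial.notMem_support_iff.1 h]

/-- If a real polynomial `v` in `d ≥ 1` variables of total degree at most `p` has vanishing
integral over every translate `α + Ŝ` of the unit simplex by a multi-index `α ∈ ℕ^d` with
`|α| ≤ p`, then `v = 0`. -/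
theorem subcell_averages_injective_on_polynomials
    (d p : ℕ) (hd : 1 ≤ d)
    (v : MvPolynomial (Fin d) ℝ) (hdeg : v.totalDegree ≤ p)
    (hzero : ∀ α : Fin d → ℕ, (∑ i, α i) ≤ p →
      ∫ x in (fun y : Fin d → ℝ => fun i => (α i : ℝ) + y i) '' unitSimplex d,
        MvPolynomial.eval x v ∂volume = 0) :
    v = 0 := by
  by_contra hv
  obtain ⟨α, hαs, hα⟩ := v.support.exists_mem_eq_sup (MvPolynomial.support_nonempty.2 hv)
    fun s => s.sum fun _ e => e
  rw [Finsupp.sum_fintype _ _ fun _ => rfl] at hα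
  replace hα : v.totalDegree = ∑ i, α i := hα
  have hint (β : Fin d → ℕ) : IntegrableOn
      (fun x : Fin d → ℝ => MvPolynomial.eval (fun i => (β i : ℝ) + x i) v) (unitSimplex d) :=
    ((MvPolynomial.continuous_eval v).comp (by fun_prop)).continuousOn.integrableOn_compact
      (isCompact_unitSimplex d)
  have hvanish : ∫ x in unitSimplex d,
      ∑ β ∈ Fintype.piFinset fun i => Finset.range (α i + 1),
        mixedDiffWeight α β * MvPolynomial.eval (fun i => (β i : ℝ) + x i) v = 0 := by
    rw [integral_finsetSum _ fun β _ => (hint β).const_mul _]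
    refine Finset.sum_eq_zero fun β hβ => ?_
    have hle : ∑ i, β i ≤ p := by
      refine (Finset.sum_le_sum fun i _ => ?_).trans (hα.symm.le.trans hdeg)
      exact Nat.lt_succ_iff.1 (Finset.mem_range.1 (Fintype.mem_piFinset.1 hβ i))
    have h := hzero β hle
    rw [setIntegral_image_add_unitSimplex] at h
    rw [integral_const_mul]
    exact mul_eq_zero_of_right _ h
  simp_rw [sum_mixedDiffWeight_mul_eval v α hα.le] at hvanish
  rw [setIntegral_const, smul_eq_mul] at hvanish
  have hvol : volume.real (unitSimplex d) ≠ 0 :=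
    (ENNReal.toReal_pos (volume_unitSimplex_pos d).ne'
      (isCompact_unitSimplex d).measure_lt_top.ne).ne'
  have hfact : ∏ i, ((α i).factorial : ℝ) ≠ 0 :=
    Finset.prod_ne_zero_iff.2 fun i _ => Nat.cast_ne_zero.2 (α i).factorial_ne_zero
  exact mul_ne_zero hvol (mul_ne_zero (MvPolynomial.mem_support_iff.1 hαs) hfact) hvanish
end

section
/- Let d ≥ 1 and p ≥ 0, and let N_p = {α ∈ ℕ^d : |α| ≤ p}. The square matrix M indexed by N_p × N_p with entries M_{αβ} = α^β = ∏_{i=1}^d α_i^{β_i} (with the convention 0^0 = 1) is invertible. (The interpolation matrix of the monomials x^β at the grid points α ∈ N_p is invertible.) -/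
instance multiIndexFinite (d p : ℕ) : Finite {α : Fin d → ℕ // ∑ i, α i ≤ p} := by
  have hle : ∀ α : {α : Fin d → ℕ // ∑ i, α i ≤ p}, ∀ i, α.1 i ≤ p := fun α i =>
    le_trans (Finset.single_le_sum (fun j _ => Nat.zero_le (α.1 j)) (Finset.mem_univ i)) α.2
  exact Finite.of_injective
    (fun α => (fun i => (⟨α.1 i, Nat.lt_succ_of_le (hle α i)⟩ : Fin (p + 1))))
    (fun a b h => Subtype.ext (funext fun i => congrArg Fin.val (congrFun h i)))

noncomputable instance multiIndexFintype (d p : ℕ) :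
    Fintype {α : Fin d → ℕ // ∑ i, α i ≤ p} := Fintype.ofFinite _

/-- A square matrix that is triangular for a partial order, with nonzero diagonal entries, is
invertible. -/
theorem Matrix.isUnit_of_triangular_of_diag_ne_zero {ι K : Type*} [Fintype ι] [DecidableEq ι]
    [PartialOrder ι] [Field K] (A : Matrix ι ι K) (htri : ∀ i j, ¬ j ≤ i → A i j = 0)
    (hdiag : ∀ i, A i i ≠ 0) : IsUnit A := by
  rw [← Matrix.mulVec_injective_iff_isUnit]
  refine (injective_iff_map_eq_zero A.mulVecLin).2 fun w hw => funext fun i => ?_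
  induction i using WellFoundedLT.induction with
  | ind i ih =>
    have hi : ∑ j, A i j * w j = 0 := congrFun hw i
    rw [Finset.sum_eq_single i (fun j _ hj => ?_) (by simp)] at hi
    · exact (mul_eq_zero.1 hi).resolve_left (hdiag i)
    · by_cases hle : j ≤ i
      · rw [ih j (lt_of_le_of_ne hle hj), Pi.zero_apply, mul_zero]
      · rw [htri i j hle, zero_mul]

/-- A product of univariate polynomials whose degrees are bounded by a multi-index of order at
most `p`, evaluated at a point, expanded in monomials of order at most `p`. -/
theorem prod_eval_eq_sum_multiIndex {R : Type*} [CommSemiring R] {d p : ℕ}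
    (P : Fin d → Polynomial R) (hP : ∑ i, (P i).natDegree ≤ p) (x : Fin d → R) :
    ∏ i, (P i).eval (x i) = ∑ β : {β : Fin d → ℕ // ∑ i, β i ≤ p},
      (∏ i, x i ^ β.1 i) * ∏ i, (P i).coeff (β.1 i) := by
  simp only [Polynomial.eval_eq_sum_range, Finset.prod_univ_sum, ← Finset.prod_mul_distrib]
  refine (Finset.sum_subset (s₂ := Finset.univ.map
      (Function.Embedding.subtype fun β : Fin d → ℕ => ∑ i, β i ≤ p))
    (fun β hβ => ?_) (fun β _ hβ => ?_)).trans ?_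
  · have hle : ∑ i, β i ≤ p := (Finset.sum_le_sum fun i _ =>
      Nat.le_of_lt_succ (Finset.mem_range.1 (Fintype.mem_piFinset.1 hβ i))).trans hP
    exact Finset.mem_map.2 ⟨⟨β, hle⟩, Finset.mem_univ _, rfl⟩
  · obtain ⟨i, hi⟩ := not_forall.1 (mt Fintype.mem_piFinset.2 hβ)
    refine Finset.prod_eq_zero (Finset.mem_univ i) ?_
    rw [Polynomial.coeff_eq_zero_of_natDegree_lt (by simpa using hi), zero_mul]
  · simp [mul_comm]

/-- The interpolation matrix `M_{αβ} = α^β = ∏ i, (α i)^(β i)` of the monomials `x^β` at the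
grid points `α ∈ N_p = {α ∈ ℕ^d : |α| ≤ p}` is invertible (convention `0^0 = 1`). -/
theorem monomial_interpolation_matrix_isUnit
    (d p : ℕ) (hd : 1 ≤ d) :
    IsUnit (Matrix.of fun α β : {α : Fin d → ℕ // ∑ i, α i ≤ p} =>
      ∏ i, (α.1 i : ℝ) ^ β.1 i) := by
  classical
  set M := Matrix.of fun α β : {α : Fin d → ℕ // ∑ i, α i ≤ p} => ∏ i, (α.1 i : ℝ) ^ β.1 i
  let C : Matrix {α : Fin d → ℕ // ∑ i, α i ≤ p} {α : Fin d → ℕ // ∑ i, α i ≤ p} ℝ :=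
    Matrix.of fun β γ => ∏ i, (descPochhammer ℝ (γ.1 i)).coeff (β.1 i)
  have hMC : ∀ α γ, (M * C) α γ = ∏ i, ((α.1 i).descFactorial (γ.1 i) : ℝ) := fun α γ => by
    simp only [← descPochhammer_eval_eq_descFactorial ℝ]
    exact (prod_eval_eq_sum_multiIndex (fun i => descPochhammer ℝ (γ.1 i))
      (by simpa only [descPochhammer_natDegree] using γ.2) fun i => (α.1 i : ℝ)).symm
  have hunit : IsUnit (M * C) := by
    refine Matrix.isUnit_of_triangular_of_diag_ne_zero _ (fun α γ hle => ?_) (fun α => ?_)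
    · obtain ⟨i, hi⟩ := not_forall.1 hle
      rw [hMC]
      refine Finset.prod_eq_zero (Finset.mem_univ i) ?_
      rw [Nat.descFactorial_of_lt (not_le.1 hi), Nat.cast_zero]
    · rw [hMC]
      exact Finset.prod_ne_zero_iff.2 fun i _ => by
        simpa only [Nat.descFactorial_self] using Nat.cast_ne_zero.2 (Nat.factorial_ne_zero _)
  rw [Matrix.isUnit_iff_isUnit_det] at hunit ⊢
  rw [Matrix.det_mul] at hunit
  exact isUnit_of_mul_isUnit_left hunit
end

section
/- Let d ≥ 1 and p ≥ 0, and let N_p = {α ∈ ℕ^d : |α| ≤ p}. The square matrix A indexed by N_p × N_p with entries A_{αβ} = ∫_{α+Ŝ} x^β dx is invertible. -/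
open MeasureTheory

/-- The `k`-th forward difference, with step one, of the monomial `t ↦ t ^ n` on `ℝ`. -/
noncomputable def powFwdDiff (n k : ℕ) : ℝ → ℝ := (fwdDiff 1)^[k] fun t : ℝ => t ^ n

theorem continuous_powFwdDiff (n k : ℕ) : Continuous (powFwdDiff n k) := by
  have h := funext (fwdDiff_iter_eq_sum_shift (1 : ℝ) (fun t : ℝ => t ^ n) k)
  rw [powFwdDiff, h]
  fun_prop

theorem powFwdDiff_eq_zero {n k : ℕ} (h : n < k) : powFwdDiff n k = 0 :=
  fwdDiff_iter_pow_eq_zero_of_lt h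

theorem powFwdDiff_self (n : ℕ) (t : ℝ) : powFwdDiff n n t = n.factorial := by
  simp [powFwdDiff, fwdDiff_iter_eq_factorial]

theorem natCast_add_pow_eq_sum_powFwdDiff {a p : ℕ} (h : a ≤ p) (n : ℕ) (t : ℝ) :
    ((a : ℝ) + t) ^ n = ∑ k ∈ Finset.range (p + 1), (a.choose k : ℝ) * powFwdDiff n k t := by
  have hs := shift_eq_sum_fwdDiff_iter (1 : ℝ) (fun t : ℝ => t ^ n) a t
  simp only [nsmul_eq_mul, mul_one] at hs
  rw [add_comm, hs]
  refine Finset.sum_subset (Finset.range_mono (Nat.succ_le_succ h)) fun k _ hk => ?_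
  rw [Nat.choose_eq_zero_of_lt (by simpa using hk), Nat.cast_zero, zero_mul]

theorem prod_natCast_choose_eq_zero {ι : Type*} [Fintype ι] {α δ : ι → ℕ} (h : ¬ δ ≤ α) :
    ∏ i, ((α i).choose (δ i) : ℝ) = 0 := by
  obtain ⟨i, hi⟩ := not_forall.1 h
  refine Finset.prod_eq_zero (Finset.mem_univ i) ?_
  rw [Nat.choose_eq_zero_of_lt (not_le.1 hi), Nat.cast_zero]

theorem prod_powFwdDiff_eq_zero {ι : Type*} [Fintype ι] {β δ : ι → ℕ} (h : ¬ δ ≤ β)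
    (x : ι → ℝ) : ∏ i, powFwdDiff (β i) (δ i) (x i) = 0 := by
  obtain ⟨i, hi⟩ := not_forall.1 h
  refine Finset.prod_eq_zero (Finset.mem_univ i) ?_
  rw [powFwdDiff_eq_zero (not_le.1 hi), Pi.zero_apply]

/-- Multivariate Newton expansion of a translated monomial. -/
theorem prod_natCast_add_pow_eq_sum {d p : ℕ} (α : {α : Fin d → ℕ // ∑ i, α i ≤ p})
    (β : Fin d → ℕ) (x : Fin d → ℝ) :
    ∏ i, ((α.1 i : ℝ) + x i) ^ β i = ∑ δ : {α : Fin d → ℕ // ∑ i, α i ≤ p},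
      (∏ i, ((α.1 i).choose (δ.1 i) : ℝ)) * ∏ i, powFwdDiff (β i) (δ.1 i) (x i) := by
  have hle (γ : {α : Fin d → ℕ // ∑ i, α i ≤ p}) (i : Fin d) : γ.1 i ≤ p :=
    (Finset.single_le_sum (fun j _ => Nat.zero_le (γ.1 j)) (Finset.mem_univ i)).trans γ.2
  simp_rw [fun i => natCast_add_pow_eq_sum_powFwdDiff (hle α i) (β i) (x i),
    Finset.prod_univ_sum, ← Finset.prod_mul_distrib]
  refine (Finset.sum_of_injOn Subtype.val Subtype.val_injective.injOn ?_ ?_ fun _ _ => rfl).symm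
  · intro δ _
    simpa [Nat.lt_succ_iff] using hle δ
  · intro δ _ hδ
    rw [Finset.prod_mul_distrib, prod_natCast_choose_eq_zero, zero_mul]
    intro hδα
    exact hδ ⟨⟨δ, (Finset.sum_le_sum fun i _ => hδα i).trans α.2⟩, by simp⟩

/-- A matrix over a finite partial order that is supported on `i ≤ j` has the product of its
diagonal entries as determinant. -/
theorem Matrix.det_of_eq_zero_of_not_le {ι R : Type*} [PartialOrder ι] [Fintype ι]
    [DecidableEq ι] [CommRing R] (M : Matrix ι ι R) (h : ∀ i j, ¬ i ≤ j → M i j = 0) :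
    M.det = ∏ i, M i i := by
  have h' (i j : ι) (hij : toLinearExtension j < toLinearExtension i) : M i j = 0 :=
    h i j fun hle => hij.not_ge (toLinearExtension.monotone hle)
  exact @Matrix.det_of_isUpperTriangular ι R M _ _ _
    (LinearOrder.lift' (toLinearExtension : ι → LinearExtension ι) fun _ _ hab => hab)
    fun i j hij => h' i j hij

/-- The square matrix `A` indexed by `N_p = {α ∈ ℕ^d : |α| ≤ p}` with entries
`A_{αβ} = ∫_{α+Ŝ} x^β dx` is invertible. -/
theorem averages_matrix_isUnit
    (d p : ℕ) (hd : 1 ≤ d) :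
    IsUnit (Matrix.of fun α β : {α : Fin d → ℕ // ∑ i, α i ≤ p} =>
      ∫ x in (fun y : Fin d → ℝ => fun i => (α.1 i : ℝ) + y i) '' unitSimplex d,
        ∏ i, x i ^ β.1 i ∂volume) := by
  let B : Matrix {α : Fin d → ℕ // ∑ i, α i ≤ p} {α : Fin d → ℕ // ∑ i, α i ≤ p} ℝ :=
    Matrix.of fun α δ => ∏ i, ((α.1 i).choose (δ.1 i) : ℝ)
  let W : Matrix {α : Fin d → ℕ // ∑ i, α i ≤ p} {α : Fin d → ℕ // ∑ i, α i ≤ p} ℝ :=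
    Matrix.of fun δ β => ∫ x in unitSimplex d, ∏ i, powFwdDiff (β.1 i) (δ.1 i) (x i)
  have hB : B.det = 1 := by
    rw [← Matrix.det_transpose, Matrix.det_of_eq_zero_of_not_le]
    · simp [B]
    · exact fun δ α h => prod_natCast_choose_eq_zero h
  have hvol : volume.real (unitSimplex d) ≠ 0 :=
    (ENNReal.toReal_pos (volume_unitSimplex_pos d).ne'
      (isCompact_unitSimplex d).measure_lt_top.ne).ne'
  have hW : W.det ≠ 0 := by
    rw [Matrix.det_of_eq_zero_of_not_le]
    · refine Finset.prod_ne_zero_iff.2 fun β _ => ?_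
      simp only [W, Matrix.of_apply, powFwdDiff_self, setIntegral_const, smul_eq_mul]
      exact mul_ne_zero hvol
        (Finset.prod_ne_zero_iff.2 fun i _ => Nat.cast_ne_zero.2 (Nat.factorial_ne_zero _))
    · intro δ β h
      have h0 := prod_powFwdDiff_eq_zero (β := β.1) (δ := δ.1) h
      simp [W, h0]
  rw [Matrix.isUnit_iff_isUnit_det, isUnit_iff_ne_zero]
  convert! mul_ne_zero (hB.trans_ne one_ne_zero) hW
  rw [← Matrix.det_mul]
  congr 1
  ext α β
  have himage := (measurePreserving_add_left (volume : Measure (Fin d → ℝ))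
    fun i => (α.1 i : ℝ)).setIntegral_image_emb (measurableEmbedding_addLeft _)
    (fun x => ∏ i, x i ^ β.1 i) (unitSimplex d)
  refine himage.trans ?_
  simp only [Pi.add_apply, prod_natCast_add_pow_eq_sum]
  rw [integral_finsetSum]
  · simp [Matrix.mul_apply, B, W, integral_const_mul]
  · intro δ _
    refine ContinuousOn.integrableOn_compact (isCompact_unitSimplex d) (Continuous.continuousOn ?_)
    exact continuous_const.mul (continuous_finsetProd _ fun i _ =>
      (continuous_powFwdDiff _ _).comp (continuous_apply i))
end

section
/- Let H be a real Hilbert space, let P : H → H be the orthogonal projection onto a closed subspace, let V ⊆ H be a finite-dimensional subspace, and let f ∈ H. For γ ≥ 0 let u_γ ∈ V be the unique element satisfying ⟨u_γ, v⟩ + γ⟨P u_γ, P v⟩ = ⟨f, v⟩ for all v ∈ V. Then as γ → ∞, u_γ converges in H to the orthogonal projection of f onto the subspace V ∩ ker P = {w ∈ V : P w = 0}. (As the penalty parameter grows, the penalized projection suppresses the polynomial modes and converges to the projection onto the unpenalized modes.) -/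
open scoped RealInnerProductSpace
open Filter

/-- On a finite-dimensional subspace `V`, a functional `⟪g, ·⟫` that vanishes on `V ∩ ker P` is
represented by the positive semidefinite form `(a, v) ↦ ⟪P a, P v⟫`. -/
theorem exists_mem_forall_inner_map_map_eq
    {H : Type*} [NormedAddCommGroup H] [InnerProductSpace ℝ H]
    (P : H →ₗ[ℝ] H)
    (hidem : ∀ u, P (P u) = P u)
    (hself : ∀ u v, ⟪P u, v⟫ = ⟪u, P v⟫)
    (V : Submodule ℝ H) [FiniteDimensional ℝ V]
    (g : H) (hg : ∀ z ∈ V, P z = 0 → ⟪g, z⟫ = 0) :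
    ∃ a ∈ V, ∀ v ∈ V, ⟪P a, P v⟫ = ⟪g, v⟫ := by
  have hPP (x y : H) : ⟪P x, P y⟫ = ⟪P x, y⟫ := by rw [← hself, hidem]
  let S : V →ₗ[ℝ] V := V.orthogonalProjectionOnto.toLinearMap ∘ₗ P ∘ₗ V.subtype
  have hS (x y : V) : ⟪S x, y⟫ = ⟪P x, (y : H)⟫ :=
    V.inner_orthogonalProjectionOnto_eq_of_mem_right y (P x)
  have hSsymm : S.IsSymmetric := fun x y => by
    rw [hS, real_inner_comm (S y) x, hS, hself, real_inner_comm]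
  have hrange : S.range = S.kerᗮ := by
    rw [← hSsymm.orthogonal_range, Submodule.orthogonal_orthogonal]
  have hmem : V.orthogonalProjectionOnto g ∈ S.range := by
    rw [hrange, Submodule.mem_orthogonal']
    intro z hz
    rw [V.inner_orthogonalProjectionOnto_eq_of_mem_right]
    refine hg z z.2 ?_
    rw [← inner_self_eq_zero (𝕜 := ℝ), hPP, ← hS, LinearMap.mem_ker.1 hz, inner_zero_left]
  obtain ⟨a, ha⟩ := hmem
  refine ⟨a, a.2, fun v hv => ?_⟩
  rw [hPP, ← hS a ⟨v, hv⟩, ha, V.inner_orthogonalProjectionOnto_eq_of_mem_right]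

/-- As the penalty parameter `γ → ∞`, the penalized projection `u_γ` (defined by
`⟨u_γ, v⟩ + γ⟨P u_γ, P v⟩ = ⟨f, v⟩` for all `v ∈ V`) converges to the orthogonal projection
`w` of `f` onto `V ∩ ker P`, characterized by `w ∈ V`, `P w = 0` and `f - w ⊥ V ∩ ker P`. -/
theorem penalized_projection_tendsto_kernel_projection
    {H : Type*} [NormedAddCommGroup H] [InnerProductSpace ℝ H] [CompleteSpace H]
    (P : H →ₗ[ℝ] H)
    (hidem : ∀ u, P (P u) = P u)
    (hself : ∀ u v, ⟪P u, v⟫ = ⟪u, P v⟫)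
    (hnorm : ∀ u, ‖P u‖ ≤ ‖u‖)
    (V : Submodule ℝ H) (hV : FiniteDimensional ℝ V)
    (f : H) (u : ℝ → H)
    (hu : ∀ γ : ℝ, 0 ≤ γ → u γ ∈ V ∧
      ∀ v ∈ V, ⟪u γ, v⟫ + γ * ⟪P (u γ), P v⟫ = ⟪f, v⟫) :
    ∃ w : H, w ∈ V ∧ P w = 0 ∧
      (∀ z ∈ V, P z = 0 → ⟪f - w, z⟫ = 0) ∧
      Tendsto u atTop (nhds w) := by
  let W : Submodule ℝ H := V ⊓ P.ker
  obtain ⟨w, hw, hfw⟩ : ∃ w ∈ W, ∀ z ∈ W, ⟪f - w, z⟫ = 0 :=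
    ⟨W.starProjection f, W.starProjection_apply_mem f,
      fun z hz => W.starProjection_inner_eq_zero f z hz⟩
  have hPw : P w = 0 := hw.2
  have horth : ∀ z ∈ V, P z = 0 → ⟪f - w, z⟫ = 0 := fun z hz hPz => hfw z ⟨hz, hPz⟩
  refine ⟨w, hw.1, hPw, horth, ?_⟩
  obtain ⟨a, haV, ha⟩ := exists_mem_forall_inner_map_map_eq P hidem hself V (f - w) horth
  have hrate (γ : ℝ) (hγ : 0 < γ) : ‖u γ - w‖ ≤ ‖a‖ / γ := by
    obtain ⟨huV, hvar⟩ := hu γ hγ.le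
    set d := u γ - w with hd
    have hdV : d ∈ V := V.sub_mem huV hw.1
    have hPd : P d = P (u γ) := by rw [hd, map_sub, hPw, sub_zero]
    have hvV : γ • d - a ∈ V := V.sub_mem (V.smul_mem γ hdV) haV
    have herr : ⟪d, γ • d - a⟫ + ⟪P (γ • d - a), P (γ • d - a)⟫ = 0 := by
      have h₁ := hvar _ hvV
      have h₂ := ha _ hvV
      rw [← hPd] at h₁
      rw [inner_sub_left] at h₂
      have h₃ : ⟪P (γ • d - a), P (γ • d - a)⟫ =
          γ * ⟪P d, P (γ • d - a)⟫ - ⟪P a, P (γ • d - a)⟫ := by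
        rw [← real_inner_smul_left, ← inner_sub_left, map_sub, map_smul]
      have h₄ : ⟪d, γ • d - a⟫ = ⟪u γ, γ • d - a⟫ - ⟪w, γ • d - a⟫ := inner_sub_left _ _ _
      linarith
    have hle : ⟪d, γ • d - a⟫ ≤ 0 := by
      linarith [real_inner_self_nonneg (x := P (γ • d - a))]
    rw [inner_sub_right, real_inner_smul_right, real_inner_self_eq_norm_sq] at hle
    have hcs := real_inner_le_norm d a
    rw [le_div_iff₀ hγ]
    rcases (norm_nonneg d).eq_or_lt with h₀ | h₀
    · rw [← h₀, zero_mul]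
      exact norm_nonneg a
    · refine le_of_mul_le_mul_left ?_ h₀
      linarith
  rw [tendsto_iff_norm_sub_tendsto_zero]
  refine squeeze_zero' (Eventually.of_forall fun γ => norm_nonneg _) ?_
    (tendsto_id.const_div_atTop ‖a‖)
  filter_upwards [eventually_gt_atTop 0] with γ hγ using hrate γ hγ
end
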